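/- For any weighted graph G̃ with n vertices, c connected components, and β = |E| - |V| + c independent loops, and any k with β < k ≤ n, we have ℓ̲_k(G̃) ≥ h_{k-β}(G̃), where ℓ̲_k(G̃) = max_{A⊆V, |A|=n-k+1} min_{∅≠B⊆A} φ(B) and h_m is the Cheeger m-constant. -/

import Mathlib

open Finset

variable {V : Type*}

noncomputable def bdryW [Fintype V] [DecidableEq V] (G : SimpleGraph V) [DecidableRel G.Adj]
    (w : Sym2 V → ℝ) (A : Finset V) : ℝ :=
  ∑ u ∈ A, ∑ v ∈ Aᶜ, if G.Adj u v then w s(u, v) else 0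

noncomputable def vol [Fintype V] (μ : V → ℝ) (A : Finset V) : ℝ := ∑ v ∈ A, μ v

noncomputable def phi [Fintype V] [DecidableEq V] (G : SimpleGraph V) [DecidableRel G.Adj]
    (μ : V → ℝ) (w : Sym2 V → ℝ) (A : Finset V) : ℝ := bdryW G w A / vol μ A

/-- A subpartition: a tuple of pairwise disjoint nonempty subsets of the vertex set. -/
def IsSubpartition {k : ℕ} (A : Fin k → Finset V) : Prop :=
  (∀ i, (A i).Nonempty) ∧ ∀ i j, i ≠ j → Disjoint (A i) (A j)

/-- The Cheeger k-constant: min over subpartitions with k parts of the max expansion. -/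
noncomputable def hkConst [Fintype V] [DecidableEq V] (G : SimpleGraph V) [DecidableRel G.Adj]
    (μ : V → ℝ) (w : Sym2 V → ℝ) (k : ℕ) : ℝ :=
  sInf {r | ∃ A : Fin k → Finset V, IsSubpartition A ∧
    r = sSup {s | ∃ i, s = phi G μ w (A i)}}

/-- Variant of the Cheeger k-constant where the maximum runs over all unions of parts. -/
noncomputable def hkUnion [Fintype V] [DecidableEq V] (G : SimpleGraph V) [DecidableRel G.Adj]
    (μ : V → ℝ) (w : Sym2 V → ℝ) (k : ℕ) : ℝ :=
  sInf {r | ∃ A : Fin k → Finset V, IsSubpartition A ∧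
    r = sSup {s | ∃ I : Finset (Fin k), I.Nonempty ∧ s = phi G μ w (I.biUnion A)}}

/-- The k-th max-min Cheeger constant ℓ_k. -/
noncomputable def ellk [Fintype V] [DecidableEq V] (G : SimpleGraph V) [DecidableRel G.Adj]
    (μ : V → ℝ) (w : Sym2 V → ℝ) (k : ℕ) : ℝ :=
  sSup {r | ∃ A : Fin (Fintype.card V - k + 1) → Finset V, IsSubpartition A ∧
    r = sInf {s | ∃ I : Finset (Fin (Fintype.card V - k + 1)), I.Nonempty ∧
      s = phi G μ w (I.biUnion A)}}

/-- The Cheeger constant of a subset A: min of φ over nonempty subsets of A. -/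
noncomputable def cheegerConst [Fintype V] [DecidableEq V] (G : SimpleGraph V) [DecidableRel G.Adj]
    (μ : V → ℝ) (w : Sym2 V → ℝ) (A : Finset V) : ℝ :=
  sInf {r | ∃ B : Finset V, B ⊆ A ∧ B.Nonempty ∧ r = phi G μ w B}

/-- The k-th Dirichlet Cheeger constant ℓ̲_k. -/
noncomputable def ellUnder [Fintype V] [DecidableEq V] (G : SimpleGraph V) [DecidableRel G.Adj]
    (μ : V → ℝ) (w : Sym2 V → ℝ) (k : ℕ) : ℝ :=
  sSup {r | ∃ A : Finset V, A.card = Fintype.card V - k + 1 ∧ r = cheegerConst G μ w A}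


/-- Cut-style connectedness of a vertex set. -/
def SConn (F : SimpleGraph V) (B : Finset V) : Prop :=
  ∀ X, X ⊂ B → X.Nonempty → ∃ x ∈ X, ∃ y ∈ B, y ∉ X ∧ F.Adj x y

lemma exists_leaf [Fintype V] (F : SimpleGraph V) (hF : F.IsAcyclic)
    (S : Finset V) (hS : S.Nonempty) :
    ∃ v ∈ S, ∀ a ∈ S, ∀ b ∈ S, F.Adj v a → F.Adj v b → a = b := by
  classical
  obtain ⟨r, hr⟩ := hS
  let H := F.induce (S : Set V)
  have hH : H.IsAcyclic := hF.induce _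
  let P : ℕ → Prop := fun n => ∃ (u v : (S : Set V)) (p : H.Walk u v), p.IsPath ∧ p.length = n
  have hP0 : P 0 := ⟨⟨r, hr⟩, ⟨r, hr⟩, SimpleGraph.Walk.nil, by simp, rfl⟩
  have hbd : ∀ n, P n → n ≤ Fintype.card (S : Set V) := by
    rintro n ⟨u, v, p, hp, rfl⟩
    exact hp.length_lt.le
  have hmax := Nat.findGreatest_spec (P := P) (Nat.zero_le (Fintype.card (S : Set V))) hP0
  obtain ⟨u, v, p, hp, hlen⟩ := hmax
  have key : ∀ w, H.Adj u w → w = p.snd := by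
    intro w hw
    apply hH.eq_snd_of_adj_start hp hw
    by_contra hns
    have hc : (SimpleGraph.Walk.cons hw.symm p).IsPath := by
      rw [SimpleGraph.Walk.cons_isPath_iff]; exact ⟨hp, hns⟩
    have hPc : P (p.length + 1) := ⟨_, _, _, hc, by simp⟩
    have := Nat.le_findGreatest (hbd _ hPc) hPc
    omega
  refine ⟨u, u.2, fun a ha b hb h1 h2 => ?_⟩
  have e1 := key ⟨a, ha⟩ h1
  have e2 := key ⟨b, hb⟩ h2
  have := e1.trans e2.symm
  simpa using this

lemma SConn.erase_leaf [DecidableEq V] {F : SimpleGraph V} {B S : Finset V} {v : V}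
    (hBS : B ⊆ S) (hv : ∀ a ∈ S, ∀ b ∈ S, F.Adj v a → F.Adj v b → a = b)
    (hB : SConn F B) : SConn F (B.erase v) := by
  by_cases hvB : v ∈ B
  swap
  · rwa [Finset.erase_eq_of_notMem hvB]
  intro X hX hne
  have hXB : X ⊆ B := hX.1.trans (Finset.erase_subset _ _)
  have hvX : v ∉ X := fun h => by simpa using hX.1 h
  obtain ⟨z, hz, hzX⟩ := Finset.exists_of_ssubset hX
  obtain ⟨x, hx, y, hy, hyX, hxy⟩ := hB X ⟨hXB, fun h => hvX (h hvB)⟩ hne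
  by_cases hyv : y = v
  · subst hyv
    obtain ⟨x', hx', y', hy', hyX', hxy'⟩ := hB (insert y X)
      ⟨by simp [Finset.insert_subset_iff, hvB, hXB], fun h => by
        have := h (Finset.mem_of_mem_erase hz)
        simp at hz
        simp [hz.1, hzX] at this⟩ (by simp)
    simp only [Finset.mem_insert, not_or] at hx' hyX'
    rcases hx' with rfl | hx'
    · have := hv x (hBS (hXB hx)) y' (hBS hy') hxy.symm hxy'
      exact absurd (this ▸ hx) hyX'.2
    · exact ⟨x', hx', y', by simp [hy', hyX'.1], hyX'.2, hxy'⟩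
  · exact ⟨x, hx, y, by simp [hy, hyv], hyX, hxy⟩

lemma forest_pack [Fintype V] [DecidableEq V] (F : SimpleGraph V) (hF : F.IsAcyclic) :
    ∀ (N : ℕ) (S : Finset V), S.card = N → ∀ P : Finset (Finset V),
      (∀ B ∈ P, B.Nonempty ∧ B ⊆ S ∧ SConn F B) →
      ∃ T : Finset V, ∃ Q ⊆ P, T.card ≤ Q.card ∧
        (∀ A ∈ Q, ∀ B ∈ Q, A ≠ B → Disjoint A B) ∧ ∀ B ∈ P, ∃ v ∈ T, v ∈ B := by
  intro N
  induction N with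
  | zero =>
    intro S hS P hP
    rw [Finset.card_eq_zero] at hS
    subst hS
    refine ⟨∅, ∅, by simp, by simp, by simp, fun B hB => ?_⟩
    obtain ⟨⟨x, hx⟩, h2, -⟩ := hP B hB
    simpa using h2 hx
  | succ N ih =>
    intro S hS P hP
    obtain ⟨v, hvS, hv⟩ := exists_leaf F hF S (Finset.card_pos.mp (by omega))
    have hcard : (S.erase v).card = N := by rw [Finset.card_erase_of_mem hvS]; omega
    by_cases hvP : {v} ∈ P
    · obtain ⟨T, Q, hQ, hTQ, hd, hh⟩ := ih (S.erase v) hcard (P.filter (fun B => v ∉ B)) (by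
        intro B hB
        rw [Finset.mem_filter] at hB
        obtain ⟨h1, h2, h3⟩ := hP B hB.1
        exact ⟨h1, Finset.subset_erase.mpr ⟨h2, hB.2⟩, h3⟩)
      have hQv : ∀ B ∈ Q, v ∉ B := fun B hB => (Finset.mem_filter.mp (hQ hB)).2
      refine ⟨insert v T, insert {v} Q, ?_, ?_, ?_, ?_⟩
      · intro B hB
        rcases Finset.mem_insert.mp hB with rfl | hB
        · exact hvP
        · exact (Finset.mem_filter.mp (hQ hB)).1
      · rw [Finset.card_insert_of_notMem (s := Q) (fun h => hQv _ h (by simp))]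
        exact (Finset.card_insert_le _ _).trans (by omega)
      · intro A hA B hB hAB
        rcases Finset.mem_insert.mp hA with rfl | hA <;> rcases Finset.mem_insert.mp hB with rfl | hB
        · exact absurd rfl hAB
        · simpa using hQv _ hB
        · simpa using hQv _ hA
        · exact hd A hA B hB hAB
      · intro B hB
        by_cases hvB : v ∈ B
        · exact ⟨v, by simp, hvB⟩
        · obtain ⟨t, ht, htB⟩ := hh B (by simp [hB, hvB])
          exact ⟨t, by simp [ht], htB⟩
    · obtain ⟨T, Q, hQ, hTQ, hd, hh⟩ := ih (S.erase v) hcard (P.image (fun B => B.erase v)) (by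
        intro B' hB'
        obtain ⟨B, hB, rfl⟩ := Finset.mem_image.mp hB'
        obtain ⟨h1, h2, h3⟩ := hP B hB
        refine ⟨?_, Finset.erase_subset_erase _ h2, h3.erase_leaf h2 hv⟩
        rw [Finset.nonempty_iff_ne_empty]
        intro he
        rw [Finset.erase_eq_empty_iff] at he
        rcases he with rfl | rfl
        · simp at h1
        · exact hvP hB)
      have hpre : ∀ C : Finset V, ∃ B, C ∈ Q → B ∈ P ∧ B.erase v = C := by
        intro C
        by_cases hC : C ∈ Q
        · obtain ⟨B, hB, h⟩ := Finset.mem_image.mp (hQ hC)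
          exact ⟨B, fun _ => ⟨hB, h⟩⟩
        · exact ⟨∅, fun h => absurd h hC⟩
      choose g hg using hpre
      have hnb : ∀ B ∈ P, v ∈ B → ∃ u ∈ B.erase v, F.Adj v u := by
        intro B hB hvB
        obtain ⟨h1, h2, h3⟩ := hP B hB
        obtain ⟨x, hx, y, hy, hyX, hxy⟩ := h3 {v} ⟨by simpa using hvB, fun h => hvP (by
          have : B = {v} := Finset.Subset.antisymm h (by simpa using hvB)
          exact this ▸ hB)⟩ (by simp)
        simp only [Finset.mem_singleton] at hx hyX
        subst hx
        exact ⟨y, by simp [hy, hyX], hxy⟩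
      refine ⟨T, Q.image g, ?_, ?_, ?_, ?_⟩
      · intro B hB
        obtain ⟨C, hC, rfl⟩ := Finset.mem_image.mp hB
        exact (hg C hC).1
      · rw [Finset.card_image_of_injOn]
        · exact hTQ
        · intro C hC D hD hCD
          rw [← (hg C hC).2, ← (hg D hD).2]
          exact congrArg (fun B => B.erase v) hCD
      · intro A hA B hB hAB
        obtain ⟨C, hC, rfl⟩ := Finset.mem_image.mp hA
        obtain ⟨D, hD, rfl⟩ := Finset.mem_image.mp hB
        have hCD : C ≠ D := fun h => hAB (by rw [h])
        have hdis := hd C hC D hD hCD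
        obtain ⟨hgC, eC⟩ := hg C hC
        obtain ⟨hgD, eD⟩ := hg D hD
        rw [Finset.disjoint_left] at hdis ⊢
        intro x hxA hxB
        by_cases hxv : x = v
        · subst hxv
          obtain ⟨a, ha, hxa⟩ := hnb _ hgC hxA
          obtain ⟨b, hb, hxb⟩ := hnb _ hgD hxB
          have hab := hv a ((hP _ hgC).2.1 (Finset.mem_of_mem_erase ha)) b
            ((hP _ hgD).2.1 (Finset.mem_of_mem_erase hb)) hxa hxb
          rw [eC] at ha
          rw [eD] at hb
          exact hdis ha (hab ▸ hb)
        · exact hdis (eC ▸ Finset.mem_erase.mpr ⟨hxv, hxA⟩) (eD ▸ Finset.mem_erase.mpr ⟨hxv, hxB⟩)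
      · intro B hB
        obtain ⟨t, ht, htB⟩ := hh (B.erase v) (Finset.mem_image_of_mem _ hB)
        exact ⟨t, ht, Finset.mem_of_mem_erase htB⟩

lemma card_vert_le [Fintype V] (F : SimpleGraph V) :
    Nat.card V ≤ Nat.card F.edgeSet + Nat.card F.ConnectedComponent := by
  classical
  let root : V → V := fun v => (F.connectedComponentMk v).out
  have hroot : ∀ v, F.Reachable (root v) v := fun v =>
    SimpleGraph.ConnectedComponent.exact (Quot.out_eq (F.connectedComponentMk v))
  have hpar : ∀ v, ∃ p, v ≠ root v → F.Adj v p ∧ F.dist p (root v) < F.dist v (root v) := by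
    intro v
    by_cases h : v = root v
    · exact ⟨v, fun h' => absurd h h'⟩
    · obtain ⟨w, hw⟩ := (hroot v).symm.exists_walk_length_eq_dist
      generalize root v = r at w hw h
      cases w with
      | nil => exact absurd rfl h
      | cons hadj q =>
        refine ⟨_, fun _ => ⟨hadj, ?_⟩⟩
        have := SimpleGraph.dist_le q
        simp at hw
        omega
  choose par hpar using hpar
  have hsame : ∀ v, v ≠ root v → root (par v) = root v := fun v h => by
    have : F.connectedComponentMk (par v) = F.connectedComponentMk v :=
      SimpleGraph.ConnectedComponent.sound (hpar v h).1.reachable.symm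
    simp only [root, this]
  let f : V → F.edgeSet ⊕ F.ConnectedComponent := fun v =>
    if h : v ≠ root v then Sum.inl ⟨s(v, par v), (hpar v h).1⟩
    else Sum.inr (F.connectedComponentMk v)
  have hf : Function.Injective f := by
    intro a b hab
    by_cases ha : a ≠ root a <;> by_cases hb : b ≠ root b
    · simp only [f, dif_pos ha, dif_pos hb, Sum.inl.injEq] at hab
      have hab := Sym2.eq_iff.mp (congrArg Subtype.val hab)
      rcases hab with ⟨h, -⟩ | ⟨h1, h2⟩
      · exact h
      · have e := hsame b hb
        rw [← h1] at e
        have p1 := (hpar a ha).2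
        have p2 := (hpar b hb).2
        rw [h2, e] at p1
        rw [← h1] at p2
        omega
    · simp only [f, dif_pos ha, dif_neg hb, reduceCtorEq] at hab
    · simp only [f, dif_neg ha, dif_pos hb, reduceCtorEq] at hab
    · simp only [f, dif_neg ha, dif_neg hb, Sum.inr.injEq] at hab
      rw [not_not] at ha hb
      rw [ha, hb]
      simp only [root, hab]
  have := Nat.card_le_card_of_injective f hf
  rwa [Nat.card_sum] at this

lemma phi_split [Fintype V] [DecidableEq V] (G : SimpleGraph V) [DecidableRel G.Adj]
    (μ : V → ℝ) (w : Sym2 V → ℝ) (hμ : ∀ v, 0 < μ v) (h : ℝ) (X Y : Finset V)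
    (hX : X.Nonempty) (hY : Y.Nonempty) (hXY : Disjoint X Y)
    (hno : ∀ x ∈ X, ∀ y ∈ Y, ¬ G.Adj x y)
    (h1 : h ≤ phi G μ w X) (h2 : h ≤ phi G μ w Y) : h ≤ phi G μ w (X ∪ Y) := by
  have hvX : 0 < vol μ X := Finset.sum_pos (fun v _ => hμ v) hX
  have hvY : 0 < vol μ Y := Finset.sum_pos (fun v _ => hμ v) hY
  have hv : vol μ (X ∪ Y) = vol μ X + vol μ Y := Finset.sum_union hXY
  have aux : ∀ X Y : Finset V, Disjoint X Y → (∀ x ∈ X, ∀ y ∈ Y, ¬ G.Adj x y) →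
      ∑ u ∈ X, ∑ v ∈ (X ∪ Y)ᶜ, (if G.Adj u v then w s(u, v) else 0) = bdryW G w X := by
    intro X Y hXY hno
    refine Finset.sum_congr rfl fun u hu => Finset.sum_subset ?_ ?_
    · exact Finset.compl_subset_compl.mpr Finset.subset_union_left
    · intro v hv hv'
      simp only [Finset.mem_compl, Finset.mem_union] at hv hv'
      have : v ∈ Y := by tauto
      rw [if_neg (hno u hu v this)]
  have hb : bdryW G w (X ∪ Y) = bdryW G w X + bdryW G w Y := by
    rw [bdryW, Finset.sum_union hXY, aux X Y hXY hno, Finset.union_comm,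
      aux Y X hXY.symm (fun y hy x hx e => hno x hx y hy e.symm)]
  unfold phi at *
  rw [le_div_iff₀ hvX] at h1
  rw [le_div_iff₀ hvY] at h2
  rw [hv, hb, le_div_iff₀ (by positivity)]
  linarith

lemma exists_bad_sconn [Fintype V] [DecidableEq V] (G : SimpleGraph V) [DecidableRel G.Adj]
    (μ : V → ℝ) (w : Sym2 V → ℝ) (hμ : ∀ v, 0 < μ v) (h : ℝ) (B : Finset V) :
    B.Nonempty → phi G μ w B < h →
      ∃ C ⊆ B, C.Nonempty ∧ phi G μ w C < h ∧ SConn G C := by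
  induction B using Finset.strongInduction with
  | H B ih =>
    intro hne hB
    by_cases hs : SConn G B
    · exact ⟨B, subset_rfl, hne, hB, hs⟩
    · unfold SConn at hs
      push Not at hs
      obtain ⟨X, hX, hXne, hno⟩ := hs
      obtain ⟨z, hz, hzX⟩ := Finset.exists_of_ssubset hX
      have hYne : (B \ X).Nonempty := ⟨z, by simp [hz, hzX]⟩
      by_cases h1 : phi G μ w X < h
      · obtain ⟨C, hC, r⟩ := ih X hX hXne h1
        exact ⟨C, hC.trans hX.1, r⟩
      by_cases h2 : phi G μ w (B \ X) < h
      · obtain ⟨C, hC, r⟩ := ih (B \ X) (Finset.sdiff_ssubset hX.1 hXne) hYne h2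
        exact ⟨C, hC.trans Finset.sdiff_subset, r⟩
      exfalso
      have := phi_split G μ w hμ h X (B \ X) hXne hYne Finset.disjoint_sdiff
        (fun x hx y hy => by
          rw [Finset.mem_sdiff] at hy
          exact hno x hx y hy.1 hy.2) (not_lt.mp h1) (not_lt.mp h2)
      rw [Finset.union_sdiff_of_subset hX.1] at this
      linarith

lemma exists_feedback [Fintype V] [DecidableEq V] (G : SimpleGraph V) [DecidableRel G.Adj] :
    ∃ F : SimpleGraph V, F.IsAcyclic ∧ ∃ T : Finset V,
      T.card ≤ G.edgeFinset.card + Nat.card G.ConnectedComponent - Fintype.card V ∧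
      ∀ x y, G.Adj x y → x ∉ T → y ∉ T → F.Adj x y := by
  classical
  obtain ⟨F, hFG, hF, hr⟩ := G.exists_isAcyclic_reachable_eq_le
  have hc : Nat.card F.ConnectedComponent = Nat.card G.ConnectedComponent := by
    unfold SimpleGraph.ConnectedComponent
    rw [hr]
  have hcard := card_vert_le F
  rw [hc, Nat.card_eq_fintype_card, Nat.card_eq_fintype_card (α := F.edgeSet),
    ← SimpleGraph.edgeFinset_card] at hcard
  have hsub : F.edgeFinset ⊆ G.edgeFinset := SimpleGraph.edgeFinset_mono hFG
  refine ⟨F, hF, (G.edgeFinset \ F.edgeFinset).image (fun e => e.out.1), ?_, ?_⟩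
  · refine Finset.card_image_le.trans ?_
    rw [Finset.card_sdiff_of_subset hsub]
    omega
  · intro x y hxy hx hy
    by_contra hn
    have hmem : s(x, y) ∈ G.edgeFinset \ F.edgeFinset := by
      simp [hxy, hn]
    have h1 := Finset.mem_image_of_mem (fun e : Sym2 V => e.out.1) hmem
    have h2 := Sym2.out_fst_mem s(x, y)
    rw [Sym2.mem_iff] at h2
    rcases h2 with h2 | h2
    · exact hx (h2 ▸ h1)
    · exact hy (h2 ▸ h1)

theorem ellUnder_ge_hk_sub_beta [Fintype V] [DecidableEq V]
    (G : SimpleGraph V) [DecidableRel G.Adj]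
    (μ : V → ℝ) (w : Sym2 V → ℝ) (hμ : ∀ v, 0 < μ v) (hw : ∀ e ∈ G.edgeSet, 0 < w e)
    (β : ℕ) (hβ : β = G.edgeFinset.card + Nat.card G.ConnectedComponent - Fintype.card V)
    (k : ℕ) (hbk : β < k) (hkn : k ≤ Fintype.card V) :
    hkConst G μ w (k - β) ≤ ellUnder G μ w k := by
  classical
  set h := hkConst G μ w (k - β) with hh
  obtain ⟨F, hF, T0, hT0, hFG⟩ := exists_feedback G
  rw [← hβ] at hT0
  let P : Finset (Finset V) := Finset.univ.filter
    (fun B => B.Nonempty ∧ (∀ x ∈ B, x ∉ T0) ∧ SConn G B ∧ phi G μ w B < h)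
  obtain ⟨T1, Q, hQP, hTQ, hd, hhit⟩ := forest_pack F hF _ Finset.univ rfl P (by
    intro B hB
    obtain ⟨-, h1, h2, h3, h4⟩ := Finset.mem_filter.mp hB
    refine ⟨h1, Finset.subset_univ _, fun X hX hne => ?_⟩
    obtain ⟨x, hx, y, hy, hyX, hxy⟩ := h3 X hX hne
    exact ⟨x, hx, y, hy, hyX, hFG x y hxy (h2 x (hX.1 hx)) (h2 y hy)⟩)
  have hQ : Q.card < k - β := by
    by_contra hcon
    rw [not_lt] at hcon
    obtain ⟨Q', hQ', hcQ'⟩ := Finset.exists_subset_card_eq hcon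
    let e := (Q'.equivFinOfCardEq hcQ').symm
    let A : Fin (k - β) → Finset V := fun i => (e i : Finset V)
    have hA : ∀ i, A i ∈ Q := fun i => hQ' (e i).2
    have hAP : ∀ i, (A i).Nonempty ∧ phi G μ w (A i) < h := fun i => by
      obtain ⟨-, h1, h2, h3, h4⟩ := Finset.mem_filter.mp (hQP (hA i))
      exact ⟨h1, h4⟩
    have hsub : IsSubpartition A := ⟨fun i => (hAP i).1, fun i j hij =>
      hd _ (hA i) _ (hA j) (fun he => hij (e.injective (Subtype.ext he)))⟩
    have hfin : {s | ∃ i, s = phi G μ w (A i)}.Finite :=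
      (Set.finite_range (fun i => phi G μ w (A i))).subset (by
        rintro s ⟨i, rfl⟩; exact ⟨i, rfl⟩)
    have hne : {s | ∃ i, s = phi G μ w (A i)}.Nonempty := ⟨_, ⟨0, by omega⟩, rfl⟩
    obtain ⟨i, hi⟩ := hne.csSup_mem hfin
    have hlt : sSup {s | ∃ i, s = phi G μ w (A i)} < h := hi ▸ (hAP i).2
    have hle : h ≤ sSup {s | ∃ i, s = phi G μ w (A i)} := by
      rw [hh]
      refine csInf_le ?_ ⟨A, hsub, rfl⟩
      refine ((Set.finite_range (fun A : Fin (k - β) → Finset V =>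
        sSup {s | ∃ i, s = phi G μ w (A i)})).subset ?_).bddBelow
      rintro r ⟨A, -, rfl⟩
      exact ⟨A, rfl⟩
    linarith
  have hTc : (T0 ∪ T1).card ≤ k - 1 := (Finset.card_union_le _ _).trans (by omega)
  obtain ⟨T, hT, hcT⟩ := Finset.exists_superset_card_eq hTc (by omega)
  have hAc : Tᶜ.card = Fintype.card V - k + 1 := by
    rw [Finset.card_compl, hcT]; omega
  have hge : h ≤ cheegerConst G μ w Tᶜ := by
    have hne : (Tᶜ).Nonempty := Finset.card_pos.mp (by omega)
    refine le_csInf ⟨_, Tᶜ, subset_rfl, hne, rfl⟩ ?_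
    rintro r ⟨B, hB, hBne, rfl⟩
    by_contra hlt
    obtain ⟨C, hC, hCne, hCh, hCs⟩ := exists_bad_sconn G μ w hμ h B hBne (not_le.mp hlt)
    have hCT : ∀ x ∈ C, x ∉ T := fun x hx => Finset.mem_compl.mp (hB (hC hx))
    obtain ⟨v, hv, hvC⟩ := hhit C (Finset.mem_filter.mpr ⟨Finset.mem_univ _, hCne,
      fun x hx hx0 => hCT x hx (hT (Finset.mem_union_left _ hx0)), hCs, hCh⟩)
    exact hCT v hvC (hT (Finset.mem_union_right _ hv))
  refine hge.trans (le_csSup ?_ ⟨Tᶜ, hAc, rfl⟩)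
  refine ((Set.finite_range (fun A : Finset V => cheegerConst G μ w A)).subset ?_).bddAbove
  rintro r ⟨A, -, rfl⟩
  exact ⟨A, rfl⟩
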